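/- (Gradient of the entropy-of-softmax objective is controlled by the entropy itself.) Let C be a finite nonempty index type and Φ(u) = H(σ(u)) for u : C → ℝ. Then for every u, the Euclidean norm of the gradient satisfies ‖∇Φ(u)‖ ≤ 2 · H(σ(u)). In particular, the gradient of the test-time entropy objective tends to 0 along any sequence of logits u_k with H(σ(u_k)) → 0. -/

import Mathlib

open Real Finset Filter

/-- Softmax: `σ(u) c = exp (u c) / ∑ j, exp (u j)`. -/
noncomputable def softmax {C : Type*} [Fintype C] (u : C → ℝ) : C → ℝ :=
  fun c => Real.exp (u c) / ∑ j, Real.exp (u j)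

/-- Shannon entropy `H(p) = −∑ c, p c * log (p c)` (natural log, `0 * log 0 = 0`). -/
noncomputable def entropy {C : Type*} [Fintype C] (p : C → ℝ) : ℝ :=
  -∑ c, p c * Real.log (p c)

/-- The entropy-of-softmax objective `Φ(u) = H(σ(u))` on Euclidean space. -/
noncomputable def entropySoftmax {C : Type*} [Fintype C] (u : EuclideanSpace ℝ C) : ℝ :=
  entropy (softmax u)

section

variable {C : Type*} [Fintype C]

theorem softmax_nonneg (u : C → ℝ) (c : C) : 0 ≤ softmax u c :=
  div_nonneg (exp_pos _).le (sum_nonneg fun _ _ => (exp_pos _).le)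

theorem entropy_eq_sum_negMulLog (p : C → ℝ) : entropy p = ∑ c, negMulLog (p c) := by
  simp [entropy, negMulLog]

theorem norm_toLp_two_le_sum {a : C → ℝ} (ha : ∀ c, 0 ≤ a c) :
    ‖WithLp.toLp 2 a‖ ≤ ∑ c, a c := by
  rw [EuclideanSpace.norm_eq]
  refine Real.sqrt_le_iff.2 ⟨sum_nonneg fun c _ => ha c, ?_⟩
  simpa using sum_sq_le_sq_sum_of_nonneg fun c (_ : c ∈ univ) => ha c

variable [Nonempty C]

theorem sum_exp_pos (u : C → ℝ) : 0 < ∑ j, Real.exp (u j) :=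
  sum_pos (fun _ _ => exp_pos _) univ_nonempty

theorem softmax_pos (u : C → ℝ) (c : C) : 0 < softmax u c :=
  div_pos (exp_pos _) (sum_exp_pos u)

theorem sum_softmax (u : C → ℝ) : ∑ c, softmax u c = 1 := by
  simp only [softmax, ← sum_div]
  exact div_self (sum_exp_pos u).ne'

theorem softmax_le_one (u : C → ℝ) (c : C) : softmax u c ≤ 1 :=
  sum_softmax u ▸ single_le_sum (fun j _ => softmax_nonneg u j) (mem_univ c)

theorem hasFDerivAt_softmax (u : EuclideanSpace ℝ C) (c : C) :
    HasFDerivAt (fun v : EuclideanSpace ℝ C => softmax v c)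
      (softmax u c • (EuclideanSpace.proj c -
        ∑ j, softmax u j • EuclideanSpace.proj j : EuclideanSpace ℝ C →L[ℝ] ℝ)) u := by
  have hexp (j : C) : HasFDerivAt (fun v : EuclideanSpace ℝ C => Real.exp (v j))
      (Real.exp (u j) • (EuclideanSpace.proj j : EuclideanSpace ℝ C →L[ℝ] ℝ)) u :=
    (EuclideanSpace.proj j : EuclideanSpace ℝ C →L[ℝ] ℝ).hasFDerivAt.exp
  have hZ := (sum_exp_pos u).ne'
  have hinv := (hasDerivAt_inv hZ).comp_hasFDerivAt u
    (HasFDerivAt.fun_sum fun j (_ : j ∈ univ) => hexp j)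
  simp only [softmax, div_eq_mul_inv]
  refine ((hexp c).fun_mul hinv).congr_fderiv ?_
  ext h
  simp only [Function.comp_apply, add_apply, smul_apply, sub_apply, _root_.sum_apply,
    PiLp.proj_apply, smul_eq_mul, mul_right_comm _ (∑ j, Real.exp (u j))⁻¹, ← sum_mul]
  field_simp
  ring

theorem hasGradientAt_entropySoftmax (u : EuclideanSpace ℝ C) :
    HasGradientAt entropySoftmax
      (WithLp.toLp 2 (fun c => negMulLog (softmax u c)) -
        entropy (softmax u) • WithLp.toLp 2 (softmax u)) u := by
  have hΦ : (entropySoftmax : EuclideanSpace ℝ C → ℝ) =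
      fun v : EuclideanSpace ℝ C => ∑ c, negMulLog (softmax v c) :=
    funext fun v => entropy_eq_sum_negMulLog _
  rw [hasGradientAt_iff_hasFDerivAt, hΦ]
  refine (HasFDerivAt.fun_sum fun c (_ : c ∈ univ) =>
    (hasDerivAt_negMulLog (softmax_pos u c).ne').comp_hasFDerivAt u
      (hasFDerivAt_softmax u c)).congr_fderiv ?_
  ext h
  simp only [_root_.sum_apply, smul_apply, sub_apply, PiLp.proj_apply, smul_eq_mul,
    InnerProductSpace.toDual_apply_apply, inner_sub_left,
    PiLp.inner_apply, PiLp.smul_apply, RCLike.inner_apply, conj_trivial]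
  set m := ∑ j, softmax u j * h j with hm
  have hterm (c : C) : (-log (softmax u c) - 1) * (softmax u c * (h c - m)) =
      h c * negMulLog (softmax u c) - m * negMulLog (softmax u c)
        - softmax u c * h c + softmax u c * m := by
    rw [negMulLog]; ring
  simp only [hterm, sum_add_distrib, sum_sub_distrib, ← mul_sum, ← sum_mul, sum_softmax,
    entropy_eq_sum_negMulLog, ← hm,
    mul_left_comm (h _), mul_comm (h _) (softmax u _)]
  ring

theorem norm_gradient_entropySoftmax_le (u : EuclideanSpace ℝ C) :
    ‖gradient entropySoftmax u‖ ≤ 2 * entropy (softmax u) := by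
  have hnonneg (c : C) : 0 ≤ negMulLog (softmax u c) :=
    negMulLog_nonneg (softmax_nonneg u c) (softmax_le_one u c)
  have hH : 0 ≤ entropy (softmax u) := by
    rw [entropy_eq_sum_negMulLog]
    exact sum_nonneg fun c _ => hnonneg c
  have hlog := norm_toLp_two_le_sum hnonneg
  rw [← entropy_eq_sum_negMulLog] at hlog
  have hp := norm_toLp_two_le_sum (softmax_nonneg u)
  rw [sum_softmax] at hp
  rw [(hasGradientAt_entropySoftmax u).gradient]
  refine (norm_sub_le _ _).trans ?_
  rw [norm_smul, Real.norm_of_nonneg hH]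
  linarith [mul_le_of_le_one_right hH hp]

end

/-- (Gradient of the entropy-of-softmax objective is controlled by the entropy
itself.)  For every `u`, `‖∇Φ(u)‖ ≤ 2 · H(σ(u))`; in particular the gradient tends
to `0` along any sequence of logits whose softmax entropy tends to `0`. -/
theorem gradient_entropy_softmax_le_two_entropy {C : Type*} [Fintype C] [Nonempty C] :
    (∀ u : EuclideanSpace ℝ C,
      ‖gradient entropySoftmax u‖ ≤ 2 * entropy (softmax u)) ∧
    (∀ v : ℕ → EuclideanSpace ℝ C,
      Tendsto (fun k => entropy (softmax (v k))) atTop (nhds 0) →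
      Tendsto (fun k => gradient entropySoftmax (v k)) atTop (nhds 0)) := by
  refine ⟨norm_gradient_entropySoftmax_le, fun v hv => ?_⟩
  refine squeeze_zero_norm (fun k => norm_gradient_entropySoftmax_le (v k)) ?_
  simpa using hv.const_mul 2
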